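/- If M is a constructible sheaf of finite-dimensional ℂ-vector spaces on the open unit disc Δ ⊂ ℂ with respect to the partition Δ = {0} ∪ Δ*, then H^1(Δ, M) = 0. -/

import Mathlib

open CategoryTheory TopologicalSpace Opposite

/-- `Disc` is the open unit disc `Δ ⊂ ℂ` as a topological space. -/
noncomputable def Disc : TopCat := TopCat.of {z : ℂ // ‖z‖ < 1}

/-- The origin `0 ∈ Δ`. -/
noncomputable def disc0 : Disc := ⟨0, by norm_num⟩

/-- The punctured disc `Δ* = Δ \ {0}`. -/
def DiscStar : Set Disc := {z : Disc | z ≠ disc0}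


section TopPart

open Topology Metric

/-- The unit disc as a bare subtype. -/
abbrev UD : Type := {z : ℂ // ‖z‖ < 1}

lemma UD.preconnected_of_convex (A : Set ℂ) (h : Convex ℝ A) (hA : ∀ b ∈ A, ‖b‖ < 1) :
    IsPreconnected (Subtype.val ⁻¹' A : Set UD) := by
  have : Subtype.val '' (Subtype.val ⁻¹' A : Set UD) = A := by
    ext b
    constructor
    · rintro ⟨x, hx, rfl⟩
      exact hx
    · intro hb
      exact ⟨⟨b, hA b hb⟩, hb, rfl⟩
  have h2 : IsPreconnected (Subtype.val '' (Subtype.val ⁻¹' A : Set UD)) := by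
    rw [this]
    exact h.isPreconnected
  exact (Topology.IsInducing.isPreconnected_image (f := (Subtype.val : UD → ℂ)) ⟨rfl⟩).1 h2

/-- truncated cone over a set -/
def UD.cone (O : Set ℂ) : Set UD := {x | ∃ b ∈ O, ∃ t : ℝ, 0 < t ∧ t ≤ 1 ∧ (x : ℂ) = t • b}

lemma UD.cone_isOpen {O : Set ℂ} (hO : IsOpen O) : IsOpen (UD.cone O) := by
  have : UD.cone O = Subtype.val ⁻¹' (⋃ t ∈ Set.Ioc (0 : ℝ) 1, (fun b : ℂ => t • b) '' O) := by
    ext x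
    simp only [UD.cone, Set.mem_ofPred_eq, Set.mem_preimage, Set.mem_iUnion, Set.mem_image,
      Set.mem_Ioc]
    constructor
    · rintro ⟨b, hb, t, h0, h1, h⟩
      exact ⟨t, ⟨h0, h1⟩, b, hb, h.symm⟩
    · rintro ⟨t, ⟨h0, h1⟩, b, hb, h⟩
      exact ⟨b, hb, t, h0, h1, h.symm⟩
  rw [this]
  refine IsOpen.preimage continuous_subtype_val ?_
  refine isOpen_iUnion fun t => isOpen_iUnion fun ht => ?_
  exact (isOpenMap_smul₀ ht.1.ne') O hO

variable {E : UD → Type} {Good : (∀ x, E x) → UD → Prop}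

lemma UD.agree
    (heq : ∀ f g (x : UD), (x : ℂ) ≠ 0 → Good f x → Good g x →
      (∀ᶠ y in 𝓝 x, f y = g y) ∨ (∀ᶠ y in 𝓝 x, f y ≠ g y))
    {S : Set UD} (hS : IsPreconnected S) (h0 : ∀ x ∈ S, (x : ℂ) ≠ 0) {f g : ∀ x, E x}
    (hf : ∀ x ∈ S, Good f x) (hg : ∀ x ∈ S, Good g x) {a : UD} (ha : a ∈ S) (hab : f a = g a)
    {b : UD} (hb : b ∈ S) : f b = g b := by
  have := hS.induction₂ (fun x y => (f x = g x ↔ f y = g y)) ?_ ?_ ?_ ha hb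
  · exact this.1 hab
  · intro x hx
    apply Filter.Eventually.filter_mono nhdsWithin_le_nhds
    rcases heq f g x (h0 x hx) (hf x hx) (hg x hx) with h | h
    · have := h.self_of_nhds
      filter_upwards [h] with y hy
      simp [hy, this]
    · have := h.self_of_nhds
      filter_upwards [h] with y hy
      simp [hy, this]
  · intro x y z _ _ _ h1 h2
    exact h1.trans h2
  · intro x y _ _ h
    exact h.symm

/-- existence of an extension of `f0` over a cone around `z` -/
def UD.Q (Good : (∀ x, E x) → UD → Prop) (f0 : ∀ x, E x) (ε : ℝ) (z : ℂ) : Prop :=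
  ∃ ρ : ℝ, 0 < ρ ∧ ρ ≤ ‖z‖ ∧ ∃ f : ∀ x, E x, (∀ x ∈ UD.cone (ball z ρ), Good f x) ∧
    ∀ x ∈ UD.cone (ball z ρ), ‖(x : ℂ)‖ < ε → f x = f0 x

lemma UD.ball_ne_zero {z b : ℂ} {ρ : ℝ} (h : ρ ≤ ‖z‖) (hb : b ∈ ball z ρ) : b ≠ 0 := by
  rintro rfl
  rw [mem_ball, dist_zero_left] at hb
  linarith

lemma UD.cone_ne_zero {z : ℂ} {ρ : ℝ} (h : ρ ≤ ‖z‖) {x : UD} (hx : x ∈ UD.cone (ball z ρ)) :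
    (x : ℂ) ≠ 0 := by
  obtain ⟨b, hb, t, h0, h1, e⟩ := hx
  rw [e]
  exact smul_ne_zero h0.ne' (UD.ball_ne_zero h hb)

lemma UD.cone_mono {O O' : Set ℂ} (h : O ⊆ O') : UD.cone O ⊆ UD.cone O' := by
  rintro x ⟨b, hb, r⟩
  exact ⟨b, h hb, r⟩

lemma UD.step_down {f0 : ∀ x, E x} {ε : ℝ} {y : ℂ} {k : ℝ} (hk : 0 < k) (hk1 : k ≤ 1)
    (hQ : UD.Q Good f0 ε y) : UD.Q Good f0 ε (k • y) := by
  obtain ⟨ρ, h0, h1, f, hf, hf'⟩ := hQ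
  have key : UD.cone (ball (k • y) (k * ρ)) ⊆ UD.cone (ball y ρ) := by
    rintro x ⟨b, hb, t, ht0, ht1, e⟩
    refine ⟨k⁻¹ • b, ?_, t * k, by positivity, by nlinarith, ?_⟩
    · rw [mem_ball, dist_eq_norm] at hb ⊢
      have : k⁻¹ • b - y = k⁻¹ • (b - k • y) := by
        rw [smul_sub, smul_smul, inv_mul_cancel₀ hk.ne', one_smul]
      rw [this, norm_smul, norm_inv, Real.norm_of_nonneg hk.le, inv_mul_lt_iff₀ hk]
      exact hb
    · rw [e, smul_smul, mul_assoc, mul_inv_cancel₀ hk.ne', mul_one]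
  refine ⟨k * ρ, by positivity, ?_, f, fun x hx => hf x (key hx), fun x hx => hf' x (key hx)⟩
  rw [norm_smul, Real.norm_of_nonneg hk.le]
  gcongr

lemma UD.step_up
    (hcongr : ∀ f g x, Good f x → (∀ᶠ y in 𝓝 x, f y = g y) → Good g x)
    (heq : ∀ f g (x : UD), (x : ℂ) ≠ 0 → Good f x → Good g x →
      (∀ᶠ y in 𝓝 x, f y = g y) ∨ (∀ᶠ y in 𝓝 x, f y ≠ g y))
    {f0 : ∀ x, E x} {ε : ℝ} (hf0 : ∀ x : UD, ‖(x : ℂ)‖ < ε → Good f0 x)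
    {p : ℂ} {δ : ℝ} (hδ : δ ≤ ‖p‖) (hδε : ∀ b ∈ ball p δ, ‖b‖ < 1)
    (hB : ∀ y : UD, (y : ℂ) ∈ ball p δ → ∀ e : E y, ∃ f : ∀ x, E x, f y = e ∧
      ∀ z : UD, (z : ℂ) ∈ ball p δ → Good f z)
    {y : ℂ} {k : ℝ} (hk : 1 < k) (hy : y ∈ ball p δ) (hky : k • y ∈ ball p δ)
    (hQ : UD.Q Good f0 ε y) : UD.Q Good f0 ε (k • y) := by
  classical
  obtain ⟨ρ₀, h0, h1, f, hf, hf'⟩ := hQ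
  have hk0 : 0 < k := by linarith
  -- shrink
  obtain ⟨ρ₁, hρ₁, hb₁⟩ := Metric.isOpen_iff.1 isOpen_ball y hy
  obtain ⟨ρ₂, hρ₂, hb₂⟩ := Metric.isOpen_iff.1 isOpen_ball (k • y) hky
  set ρ := min ρ₀ ρ₁ with hρ
  have hρ0 : 0 < ρ := lt_min h0 hρ₁
  have hOB : ball y ρ ⊆ ball p δ := (ball_subset_ball (min_le_right _ _)).trans hb₁
  have hcc : UD.cone (ball y ρ) ⊆ UD.cone (ball y ρ₀) :=
    UD.cone_mono (ball_subset_ball (min_le_left _ _))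
  have hselfc : ∀ x : UD, (x : ℂ) ∈ ball y ρ → x ∈ UD.cone (ball y ρ) := fun x hx =>
    ⟨x, hx, 1, one_pos, le_rfl, by simp⟩
  let y' : UD := ⟨y, hδε y hy⟩
  obtain ⟨g, hgy, hg⟩ := hB y' hy (f y')
  -- agreement on the ball
  have hag1 : ∀ x : UD, (x : ℂ) ∈ ball y ρ → f x = g x := by
    intro x hx
    have hpc : IsPreconnected (Subtype.val ⁻¹' (ball y ρ) : Set UD) := by
      apply UD.preconnected_of_convex
      · exact convex_ball _ _
      · intro b hb
        exact hδε b (hOB hb)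
    refine UD.agree heq hpc (fun x hx => ?_) (fun x hx => hf x (hcc (hselfc x hx)))
      (fun x hx => hg x (hOB hx)) (a := y') (mem_ball_self hρ0) hgy.symm hx
    exact UD.ball_ne_zero hδ (hOB hx)
  have hag2 : ∀ x : UD, (x : ℂ) ∈ ball p δ → x ∈ UD.cone (ball y ρ) → f x = g x := by
    rintro x hxB ⟨b, hb, t, ht0, ht1, e⟩
    let b' : UD := ⟨b, hδε b (hOB hb)⟩
    have hseg : segment ℝ (x : ℂ) b ⊆ ball p δ := (convex_ball p δ).segment_subset hxB (hOB hb)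
    have hpc : IsPreconnected (Subtype.val ⁻¹' (segment ℝ (x : ℂ) b) : Set UD) := by
      apply UD.preconnected_of_convex
      · exact convex_segment _ _
      · intro b hb
        exact hδε b (hseg hb)
    have hcone : ∀ w : UD, (w : ℂ) ∈ segment ℝ (x : ℂ) b → w ∈ UD.cone (ball y ρ) := by
      rintro w ⟨α, β, hα, hβ, hαβ, hw⟩
      refine ⟨b, hb, α * t + β, ?_, by nlinarith, ?_⟩
      · rcases hα.eq_or_lt with rfl | hα
        · have : β = 1 := by linarith
          simp [this]
        · positivity
      · rw [← hw, e, add_smul, mul_smul]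
    refine UD.agree heq hpc (fun x hx => UD.ball_ne_zero hδ (hseg hx))
      (fun x hx => hf x (hcc (hcone x hx)))
      (fun x hx => hg x (hseg hx)) (a := b') (right_mem_segment ℝ _ _) (hag1 b' hb)
      (left_mem_segment ℝ _ _)
  let h : ∀ x, E x := fun x => if x ∈ UD.cone (ball y ρ) then f x else g x
  have hh1 : ∀ x ∈ UD.cone (ball y ρ), h x = f x := fun x hx => if_pos hx
  have hh2 : ∀ x : UD, (x : ℂ) ∈ ball p δ → h x = g x := by
    intro x hx
    by_cases hc : x ∈ UD.cone (ball y ρ)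
    · rw [hh1 x hc, hag2 x hx hc]
    · exact if_neg hc
  have hG1 : ∀ x ∈ UD.cone (ball y ρ), Good h x := by
    intro x hx
    refine hcongr f h x (hf x (hcc hx)) ?_
    filter_upwards [(UD.cone_isOpen isOpen_ball).mem_nhds hx] with w hw
    exact (hh1 w hw).symm
  have hG2 : ∀ x : UD, (x : ℂ) ∈ ball p δ → Good h x := by
    intro x hx
    refine hcongr g h x (hg x hx) ?_
    filter_upwards [(isOpen_ball.preimage continuous_subtype_val).mem_nhds hx] with w hw
    exact (hh2 w hw).symm
  -- new radius
  have hnorm : ‖y‖ ≤ ‖k • y‖ := by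
    rw [norm_smul, Real.norm_of_nonneg hk0.le]
    nlinarith [norm_nonneg y]
  have hρ' : ρ ≤ ‖y‖ := (min_le_left _ _).trans h1
  have hdown : ∀ b ∈ ball (k • y) (min ρ ρ₂), k⁻¹ • b ∈ ball y ρ := by
    intro b hb
    have hb : b ∈ ball (k • y) ρ := ball_subset_ball (min_le_left _ _) hb
    rw [mem_ball, dist_eq_norm] at hb ⊢
    have : k⁻¹ • b - y = k⁻¹ • (b - k • y) := by
      rw [smul_sub, smul_smul, inv_mul_cancel₀ hk0.ne', one_smul]
    rw [this, norm_smul, norm_inv, Real.norm_of_nonneg hk0.le, inv_mul_lt_iff₀ hk0]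
    nlinarith
  have hcov : ∀ x ∈ UD.cone (ball (k • y) (min ρ ρ₂)),
      x ∈ UD.cone (ball y ρ) ∨ ((x : ℂ) ∈ ball p δ ∧ ∃ w : UD, w ∈ UD.cone (ball y ρ) ∧
        (w : ℂ) ∈ ball p δ ∧ ‖(w : ℂ)‖ ≤ ‖(x : ℂ)‖ ∧ segment ℝ (w : ℂ) x ⊆ ball p δ) := by
    rintro x ⟨b, hb, t, ht0, ht1, e⟩
    have hbB : b ∈ ball p δ := hb₂ (ball_subset_ball (min_le_right _ _) hb)
    by_cases htk : t * k ≤ 1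
    · left
      exact ⟨k⁻¹ • b, hdown b hb, t * k, by positivity, htk, by
        rw [e, smul_smul, mul_assoc, mul_inv_cancel₀ hk0.ne', mul_one]⟩
    · right
      push Not at htk
      have hwB := hOB (hdown b hb)
      have hxB : (x : ℂ) ∈ ball p δ := by
        apply (convex_ball p δ).segment_subset hwB hbB
        have hki : k⁻¹ < t := by
          rw [inv_lt_iff_one_lt_mul₀ hk0]; linarith
        have hk1 : k⁻¹ < 1 := inv_lt_one_of_one_lt₀ hk
        refine ⟨(1 - t) / (1 - k⁻¹), (t - k⁻¹) / (1 - k⁻¹), ?_, ?_, ?_, ?_⟩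
        · apply div_nonneg <;> linarith
        · apply div_nonneg <;> linarith
        · rw [← add_div, div_eq_one_iff_eq] <;> linarith
        · rw [smul_smul, ← add_smul, e]
          congr 1
          have : 1 - k⁻¹ ≠ 0 := by linarith
          rw [div_mul_eq_mul_div, ← add_div, div_eq_iff this]
          ring
      have hsx : k⁻¹ • b = (t * k)⁻¹ • (x : ℂ) := by
        rw [e, smul_smul]
        congr 1
        field_simp
      refine ⟨hxB, ⟨k⁻¹ • b, hδε _ hwB⟩, hselfc _ (hdown b hb), hwB, ?_,
        (convex_ball p δ).segment_subset hwB hxB⟩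
      show ‖k⁻¹ • b‖ ≤ ‖(x : ℂ)‖
      rw [hsx, norm_smul, Real.norm_of_nonneg (by positivity)]
      have : (t * k)⁻¹ ≤ 1 := (inv_lt_one_of_one_lt₀ htk).le
      nlinarith [norm_nonneg (x : ℂ)]
  refine ⟨min ρ ρ₂, lt_min hρ0 hρ₂, (min_le_left _ _).trans (hρ'.trans hnorm), h, ?_, ?_⟩
  · intro x hx
    rcases hcov x hx with hx | hx
    · exact hG1 x hx
    · exact hG2 x hx.1
  · intro x hx hxε
    rcases hcov x hx with hx | ⟨hxB, w, hwc, hwB, hwx, hseg⟩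
    · rw [hh1 x hx]
      exact hf' x (hcc hx) hxε
    · have hwε : ‖(w : ℂ)‖ < ε := hwx.trans_lt hxε
      have hsegε : segment ℝ (w : ℂ) x ⊆ ball 0 ε :=
        (convex_ball 0 ε).segment_subset (by simpa using hwε) (by simpa using hxε)
      have hpc : IsPreconnected (Subtype.val ⁻¹' (segment ℝ (w : ℂ) x) : Set UD) :=
        UD.preconnected_of_convex _ (convex_segment _ _) fun b hb => hδε b (hseg hb)
      refine UD.agree heq hpc (fun x hx => UD.ball_ne_zero hδ (hseg hx))
        (fun x hx => hG2 x (hseg hx)) (fun x hx => hf0 x (by simpa using hsegε hx))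
        (a := w) (left_mem_segment ℝ _ _) ?_ (right_mem_segment ℝ _ _)
      rw [hh1 w hwc]
      exact hf' w (hcc hwc) hwε

theorem UD.extend
    (hcongr : ∀ f g x, Good f x → (∀ᶠ y in 𝓝 x, f y = g y) → Good g x)
    (heq : ∀ f g (x : UD), (x : ℂ) ≠ 0 → Good f x → Good g x →
      (∀ᶠ y in 𝓝 x, f y = g y) ∨ (∀ᶠ y in 𝓝 x, f y ≠ g y))
    (hconst : ∀ x : UD, (x : ℂ) ≠ 0 → ∃ W : Set UD, IsOpen W ∧ x ∈ W ∧
      ∀ y ∈ W, ∀ e : E y, ∃ f : ∀ x, E x, f y = e ∧ ∀ z ∈ W, Good f z)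
    (h0 : ∃ (f : ∀ x, E x) (W : Set UD), IsOpen W ∧ ⟨0, by norm_num⟩ ∈ W ∧ ∀ z ∈ W, Good f z) :
    ∃ f : ∀ x, E x, ∀ x, Good f x := by
  classical
  obtain ⟨f0, W0, hW0, h0W, hgW⟩ := h0
  obtain ⟨ε, hε, hεW⟩ := Metric.isOpen_iff.1 hW0 _ h0W
  have hf0 : ∀ x : UD, ‖(x : ℂ)‖ < ε → Good f0 x := by
    intro x hx
    apply hgW
    apply hεW
    rw [mem_ball, Subtype.dist_eq, dist_zero_right]
    exact hx
  have hQsmall : ∀ z : ℂ, z ≠ 0 → ‖z‖ < ε → UD.Q Good f0 ε z := by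
    intro z hz hzε
    refine ⟨min ‖z‖ (ε - ‖z‖), lt_min (norm_pos_iff.2 hz) (by linarith), min_le_left _ _, f0, ?_,
      fun _ _ _ => rfl⟩
    rintro x ⟨b, hb, t, ht0, ht1, e⟩
    apply hf0
    rw [e, norm_smul, Real.norm_of_nonneg ht0.le]
    have hb : b ∈ ball z (ε - ‖z‖) := ball_subset_ball (min_le_right _ _) hb
    rw [mem_ball, dist_eq_norm] at hb
    have : ‖b‖ ≤ ‖b - z‖ + ‖z‖ := by simpa using norm_add_le (b - z) z
    nlinarith [norm_nonneg b]
  have hQ : ∀ z : UD, (z : ℂ) ≠ 0 → UD.Q Good f0 ε z := by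
    intro z hz
    have hz0 : 0 < ‖(z : ℂ)‖ := norm_pos_iff.2 hz
    have hz1 : ‖(z : ℂ)‖ < 1 := z.2
    have hpc : _root_.IsPreconnected (Set.Ioc (0 : ℝ) 1) := isPreconnected_Ioc
    let s : ℝ := min 1 (ε / 2 / ‖(z : ℂ)‖)
    have hs : 0 < s := lt_min one_pos (by positivity)
    have hs1 : s ≤ 1 := min_le_left _ _
    have := hpc.induction₂' (fun a b => UD.Q Good f0 ε (a • (z : ℂ)) → UD.Q Good f0 ε (b • (z : ℂ)))
      ?_ (fun x y z _ _ _ h1 h2 h => h2 (h1 h)) (x := s) (y := 1) ⟨hs, hs1⟩ ⟨one_pos, le_rfl⟩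
    · rw [one_smul] at this
      apply this
      apply hQsmall _ (smul_ne_zero hs.ne' hz)
      rw [norm_smul, Real.norm_of_nonneg hs.le]
      have : s ≤ ε / 2 / ‖(z : ℂ)‖ := min_le_right _ _
      rw [le_div_iff₀ hz0] at this
      linarith
    · intro a ha
      have hap : ‖a • (z : ℂ)‖ < 1 := by
        rw [norm_smul, Real.norm_of_nonneg ha.1.le]
        nlinarith [ha.2]
      have haz : a • (z : ℂ) ≠ 0 := smul_ne_zero ha.1.ne' hz
      obtain ⟨W, hW, haW, hWg⟩ := hconst ⟨a • (z : ℂ), hap⟩ haz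
      obtain ⟨δ', hδ', hδW⟩ := Metric.isOpen_iff.1 hW _ haW
      set p := a • (z : ℂ) with hp
      let δ := min δ' (min ‖p‖ (1 - ‖p‖))
      have hδ0 : 0 < δ := lt_min hδ' (lt_min (norm_pos_iff.2 haz) (by linarith))
      have hδp : δ ≤ ‖p‖ := (min_le_right _ _).trans (min_le_left _ _)
      have hδ1 : δ ≤ 1 - ‖p‖ := (min_le_right _ _).trans (min_le_right _ _)
      have hδε : ∀ b ∈ ball p δ, ‖b‖ < 1 := by
        intro b hb
        rw [mem_ball, dist_eq_norm] at hb
        have : ‖b‖ ≤ ‖b - p‖ + ‖p‖ := by simpa using norm_add_le (b - p) p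
        linarith
      have hsub : ∀ y : UD, (y : ℂ) ∈ ball p δ → y ∈ W := by
        intro y hy
        apply hδW
        rw [mem_ball, Subtype.dist_eq]
        exact lt_of_lt_of_le hy (min_le_left _ _)
      have hB : ∀ y : UD, (y : ℂ) ∈ ball p δ → ∀ e : E y, ∃ f : ∀ x, E x, f y = e ∧
          ∀ z : UD, (z : ℂ) ∈ ball p δ → Good f z := by
        intro y hy e
        obtain ⟨f, h1, h2⟩ := hWg y (hsub y hy) e
        exact ⟨f, h1, fun z hz => h2 z (hsub z hz)⟩
      have hstep : ∀ c d : ℝ, 0 < c → 0 < d → c • (z : ℂ) ∈ ball p δ → d • (z : ℂ) ∈ ball p δ →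
          UD.Q Good f0 ε (c • (z : ℂ)) → UD.Q Good f0 ε (d • (z : ℂ)) := by
        intro c d hc hd hcB hdB hQc
        have e : d • (z : ℂ) = (d / c) • (c • (z : ℂ)) := by
          rw [smul_smul, div_mul_cancel₀ _ hc.ne']
        rw [e] at hdB ⊢
        by_cases hcd : d / c ≤ 1
        · exact UD.step_down (by positivity) hcd hQc
        · exact UD.step_up hcongr heq hf0 hδp hδε hB (not_le.1 hcd) hcB hdB hQc
      have hev : ∀ᶠ b : ℝ in 𝓝 a, b • (z : ℂ) ∈ ball p δ := by
        have hc : Continuous fun b : ℝ => b • (z : ℂ) := by fun_prop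
        exact hc.continuousAt.eventually (ball_mem_nhds p hδ0)
      filter_upwards [self_mem_nhdsWithin, nhdsWithin_le_nhds hev] with b hb hbB
      exact ⟨hstep a b ha.1 hb.1 (mem_ball_self hδ0) hbB,
        hstep b a hb.1 ha.1 hbB (mem_ball_self hδ0)⟩
  have : Nonempty (∀ x, E x) := ⟨f0⟩
  choose! ρ hρ0 hρz F hF hFε using hQ
  have hself : ∀ z : UD, (z : ℂ) ≠ 0 → ∀ b : UD, (b : ℂ) ∈ ball (z : ℂ) (ρ z) → 
      b ∈ UD.cone (ball (z : ℂ) (ρ z)) := fun z _ b hb => ⟨b, hb, 1, one_pos, le_rfl, by simp⟩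
  have hFF : ∀ z : UD, (z : ℂ) ≠ 0 → ∀ b : UD, (b : ℂ) ∈ ball (z : ℂ) (ρ z) → F z b = F b b := by
    intro z hz b hb
    have hb0 : (b : ℂ) ≠ 0 := UD.ball_ne_zero (hρz z hz) hb
    have hbn : 0 < ‖(b : ℂ)‖ := norm_pos_iff.2 hb0
    let s : ℝ := min 1 (ε / 2 / ‖(b : ℂ)‖)
    have hs : 0 < s := lt_min one_pos (by positivity)
    have hs1 : s ≤ 1 := min_le_left _ _
    have hsε : ‖s • (b : ℂ)‖ < ε := by
      rw [norm_smul, Real.norm_of_nonneg hs.le]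
      have : s ≤ ε / 2 / ‖(b : ℂ)‖ := min_le_right _ _
      rw [le_div_iff₀ hbn] at this
      linarith
    have hsn : ‖s • (b : ℂ)‖ < 1 := by
      rw [norm_smul, Real.norm_of_nonneg hs.le]
      have := b.2
      nlinarith
    have hseg : ∀ w ∈ segment ℝ (s • (b : ℂ)) b, ∃ t : ℝ, 0 < t ∧ t ≤ 1 ∧ w = t • (b : ℂ) := by
      rintro w ⟨α, β, hα, hβ, hαβ, hw⟩
      refine ⟨α * s + β, ?_, by nlinarith, ?_⟩
      · rcases hα.eq_or_lt with rfl | hα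
        · have : β = 1 := by linarith
          simp [this]
        · positivity
      · rw [← hw, add_smul, mul_smul]
    have hpc : IsPreconnected (Subtype.val ⁻¹' (segment ℝ (s • (b : ℂ)) b) : Set UD) := by
      refine UD.preconnected_of_convex _ (convex_segment _ _) fun w hw => ?_
      obtain ⟨t, ht0, ht1, rfl⟩ := hseg w hw
      rw [norm_smul, Real.norm_of_nonneg ht0.le]
      have := b.2
      nlinarith
    have hc1 : ∀ w : UD, (w : ℂ) ∈ segment ℝ (s • (b : ℂ)) b →
        w ∈ UD.cone (ball (z : ℂ) (ρ z)) := by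
      intro w hw
      obtain ⟨t, ht0, ht1, e⟩ := hseg w hw
      exact ⟨b, hb, t, ht0, ht1, e⟩
    have hc2 : ∀ w : UD, (w : ℂ) ∈ segment ℝ (s • (b : ℂ)) b →
        w ∈ UD.cone (ball (b : ℂ) (ρ b)) := by
      intro w hw
      obtain ⟨t, ht0, ht1, e⟩ := hseg w hw
      exact ⟨b, mem_ball_self (hρ0 b hb0), t, ht0, ht1, e⟩
    let a : UD := ⟨s • (b : ℂ), hsn⟩
    have haS : (a : ℂ) ∈ segment ℝ (s • (b : ℂ)) b := left_mem_segment ℝ _ _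
    refine UD.agree heq hpc (fun w hw => UD.cone_ne_zero (hρz z hz) (hc1 w hw))
      (fun w hw => hF z hz w (hc1 w hw)) (fun w hw => hF b hb0 w (hc2 w hw)) (a := a)
      haS ?_ (right_mem_segment ℝ _ _)
    rw [hFε z hz a (hc1 a haS) hsε, hFε b hb0 a (hc2 a haS) hsε]
  refine ⟨fun x => if (x : ℂ) = 0 then f0 x else F x x, fun x => ?_⟩
  by_cases hx : (x : ℂ) = 0
  · refine hcongr f0 _ x (hf0 x (by simpa [hx] using hε)) ?_
    have : ∀ᶠ y : UD in 𝓝 x, ‖(y : ℂ)‖ < ε := by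
      have hc : Continuous fun y : UD => ‖(y : ℂ)‖ := by fun_prop
      exact hc.continuousAt.eventually_lt continuousAt_const (by simpa [hx] using hε)
    filter_upwards [this] with y hy
    by_cases hy0 : (y : ℂ) = 0
    · simp [hy0]
    · rw [if_neg hy0, hFε y hy0 y (hself y hy0 y (mem_ball_self (hρ0 y hy0))) hy]
  · refine hcongr (F x) _ x (hF x hx x (hself x hx x (mem_ball_self (hρ0 x hx)))) ?_
    filter_upwards [(isOpen_ball.preimage continuous_subtype_val).mem_nhds
      (mem_ball_self (hρ0 x hx) : (x : ℂ) ∈ ball (x : ℂ) (ρ x))] with b hb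
    rw [if_neg (UD.ball_ne_zero (hρz x hx) hb), hFF x hx b hb]

end TopPart

section SheafPart

open Topology

variable (M : TopCat.Sheaf (ModuleCat ℂ) Disc) {ι : Type} (U : ι → Opens Disc)
  (c : ∀ i j : ι, M.presheaf.obj (op (U i ⊓ U j)))

/-- stalks -/
abbrev St (x : Disc) : Type := M.presheaf.stalk x

/-- germ of a section -/
noncomputable def gm {V : Opens Disc} (x : Disc) (hx : x ∈ V) (s : M.presheaf.obj (op V)) : St M x :=
  M.presheaf.germ V x hx s

variable {M}

lemma gm_add {V : Opens Disc} (x : Disc) (hx : x ∈ V) (s t : M.presheaf.obj (op V)) :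
    gm M x hx (s + t) = gm M x hx s + gm M x hx t := by
  simp [gm]

lemma gm_sub {V : Opens Disc} (x : Disc) (hx : x ∈ V) (s t : M.presheaf.obj (op V)) :
    gm M x hx (s - t) = gm M x hx s - gm M x hx t := by
  simp [gm]

lemma gm_zero {V : Opens Disc} (x : Disc) (hx : x ∈ V) :
    gm M x hx (0 : M.presheaf.obj (op V)) = 0 := by
  simp [gm]

lemma gm_res {V W : Opens Disc} (i : W ⟶ V) (x : Disc) (hx : x ∈ W) (s : M.presheaf.obj (op V)) :
    gm M x hx (M.presheaf.map i.op s) = gm M x (i.le hx) s :=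
  M.presheaf.germ_res_apply i x hx s

lemma gm_eq {V W : Opens Disc} (x : Disc) (hV : x ∈ V) (hW : x ∈ W) (s : M.presheaf.obj (op V))
    (t : M.presheaf.obj (op W)) (h : gm M x hV s = gm M x hW t) :
    ∃ O : Opens Disc, x ∈ O ∧ ∃ (h1 : O ≤ V) (h2 : O ≤ W), ∀ y (hy : y ∈ O),
      gm M y (h1 hy) s = gm M y (h2 hy) t := by
  obtain ⟨O, hO, i1, i2, e⟩ := M.presheaf.germ_eq x hV hW s t h
  refine ⟨O, hO, i1.le, i2.le, fun y hy => ?_⟩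
  rw [← gm_res i1 y hy, ← gm_res i2 y hy]
  exact congrArg (gm M y hy) e

lemma gm_ext {V : Opens Disc} (s t : M.presheaf.obj (op V))
    (h : ∀ x (hx : x ∈ V), gm M x hx s = gm M x hx t) : s = t :=
  TopCat.Presheaf.section_ext M V s t h

/-- locally germ-represented functions come from sections -/
lemma exists_section (V : Opens Disc) (h : ∀ x, St M x)
    (hl : ∀ x ∈ V, ∃ (W : Opens Disc) (_ : x ∈ W) (_ : W ≤ V) (s : M.presheaf.obj (op W)),
      ∀ y (hy : y ∈ W), h y = gm M y hy s) :
    ∃ s : M.presheaf.obj (op V), ∀ y (hy : y ∈ V), gm M y hy s = h y := by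
  choose W hxW hWV s hs using fun x : V => hl x.1 x.2
  obtain ⟨t, ht, -⟩ := M.existsUnique_gluing' W V (fun x => homOfLE (hWV x))
    (fun x hx => Opens.mem_iSup.2 ⟨⟨x, hx⟩, hxW ⟨x, hx⟩⟩) s (by
      intro a b
      apply gm_ext (M := M)
      intro y hy
      have h1 := gm_res (M := M) (Opens.infLELeft (W a) (W b)) y hy (s a)
      have h2 := gm_res (M := M) (Opens.infLERight (W a) (W b)) y hy (s b)
      refine h1.trans (Eq.trans ?_ h2.symm)
      rw [← hs, ← hs])
  refine ⟨t, fun y hy => ?_⟩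
  have := gm_res (homOfLE (hWV ⟨y, hy⟩)) y (hxW ⟨y, hy⟩) t
  rw [← this, hs ⟨y, hy⟩ y (hxW ⟨y, hy⟩)]
  exact congrArg (gm M y _) (ht ⟨y, hy⟩)

open Classical in
/-- germ of the cocycle, extended by zero -/
noncomputable def cg (i j : ι) (y : Disc) : St M y :=
  if h : y ∈ U i ⊓ U j then gm M y h (c i j) else 0

lemma cg_eq (i j : ι) (y : Disc) (h : y ∈ U i ⊓ U j) : cg U c i j y = gm M y h (c i j) :=
  dif_pos h

variable (idx : Disc → ι)

/-- local representability as a section of the torsor -/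
def Gd (f : ∀ x, St M x) (x : Disc) : Prop :=
  ∃ (W : Opens Disc) (_ : x ∈ W) (i : ι) (_ : W ≤ U i) (t : M.presheaf.obj (op W)),
    ∀ y (hy : y ∈ W), f y = gm M y hy t + cg U c i (idx y) y

lemma Gd_congr (f g : ∀ x, St M x) (x : Disc) (h : Gd U c idx f x)
    (hfg : ∀ᶠ y in 𝓝 x, f y = g y) : Gd U c idx g x := by
  obtain ⟨W, hx, i, hW, t, ht⟩ := h
  obtain ⟨O, hO, hOo, hxO⟩ := eventually_nhds_iff.1 hfg
  let O' : Opens Disc := ⟨O, hOo⟩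
  refine ⟨W ⊓ O', ⟨hx, hxO⟩, i, inf_le_left.trans hW,
    M.presheaf.map (homOfLE (inf_le_left : W ⊓ O' ≤ W)).op t, fun y hy => ?_⟩
  rw [gm_res, ← ht y hy.1, hO y hy.2]

lemma Gd_diff (hidx : ∀ x, x ∈ U (idx x))
    (hc : ∀ i j k y, y ∈ U i → y ∈ U j → y ∈ U k →
      cg U c i j y + cg U c j k y = cg U c i k y)
    (f g : ∀ x, St M x) (x : Disc) (hf : Gd U c idx f x) (hg : Gd U c idx g x) :
    ∃ (V : Opens Disc) (_ : x ∈ V) (s : M.presheaf.obj (op V)), ∀ y (hy : y ∈ V),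
      f y = g y + gm M y hy s := by
  obtain ⟨W, hx, i, hW, t, ht⟩ := hf
  obtain ⟨W', hx', j, hW', t', ht'⟩ := hg
  refine ⟨W ⊓ W', ⟨hx, hx'⟩, M.presheaf.map (homOfLE (inf_le_left : W ⊓ W' ≤ W)).op t
    - M.presheaf.map (homOfLE (inf_le_right : W ⊓ W' ≤ W')).op t'
    + M.presheaf.map (homOfLE (inf_le_inf hW hW' : W ⊓ W' ≤ U i ⊓ U j)).op (c i j),
    fun y hy => ?_⟩
  have := hc i j (idx y) y (hW hy.1) (hW' hy.2) (hidx y)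
  rw [gm_add, gm_sub, gm_res, gm_res, gm_res, ht y hy.1, ht' y hy.2, ← this,
    cg_eq U c i j y ⟨hW hy.1, hW' hy.2⟩]
  abel

lemma Gd_heq (hidx : ∀ x, x ∈ U (idx x))
    (hc : ∀ i j k y, y ∈ U i → y ∈ U j → y ∈ U k →
      cg U c i j y + cg U c j k y = cg U c i k y)
    (hloc : ∀ x ∈ DiscStar, ∃ U : Opens Disc, x ∈ U ∧ (U : Set Disc) ⊆ DiscStar ∧
      ∀ (y : Disc) (hy : y ∈ U), IsIso (M.presheaf.germ U y hy))
    (f g : ∀ x, St M x) (x : Disc) (hx0 : x ∈ DiscStar) (hf : Gd U c idx f x)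
    (hg : Gd U c idx g x) :
    (∀ᶠ y in 𝓝 x, f y = g y) ∨ (∀ᶠ y in 𝓝 x, f y ≠ g y) := by
  obtain ⟨V, hxV, s, hs⟩ := Gd_diff U c idx hidx hc f g x hf hg
  obtain ⟨W, hxW, -, hW⟩ := hloc x hx0
  have hbij : ∀ y (hy : y ∈ W), Function.Bijective (gm M (V := W) y hy) := fun y hy =>
    have := hW y hy
    (ConcreteCategory.bijective_of_isIso (M.presheaf.germ W y hy))
  obtain ⟨t, ht⟩ := (hbij x hxW).2 (gm M x hxV s)
  obtain ⟨O, hxO, h1, h2, hO⟩ := gm_eq x hxW hxV t s ht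
  have hmem : ∀ᶠ y in 𝓝 x, y ∈ O := O.2.mem_nhds hxO
  by_cases h0 : t = 0
  · left
    filter_upwards [hmem] with y hy
    rw [hs y (h2 hy), ← hO y hy, h0, gm_zero, add_zero]
  · right
    filter_upwards [hmem] with y hy e
    rw [hs y (h2 hy), ← hO y hy, add_eq_left] at e
    exact h0 ((hbij y (h1 hy)).1 (e.trans (gm_zero y (h1 hy)).symm))

open Classical in
lemma Gd_of_section (W : Opens Disc) (i : ι) (hW : W ≤ U i) (t : M.presheaf.obj (op W)) :
    ∃ f : ∀ x, St M x, (∀ y (hy : y ∈ W), f y = gm M y hy t + cg U c i (idx y) y) ∧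
      ∀ z ∈ W, Gd U c idx f z := by
  have key : ∀ y (hy : y ∈ W), (fun y => if hy : y ∈ W then
      gm M y hy t + cg U c i (idx y) y else 0 : ∀ x, St M x) y
      = gm M y hy t + cg U c i (idx y) y := fun y hy => dif_pos hy
  exact ⟨_, key, fun z hz => ⟨W, hz, i, hW, t, key⟩⟩

lemma Gd_const (hidx : ∀ x, x ∈ U (idx x))
    (hloc : ∀ x ∈ DiscStar, ∃ U : Opens Disc, x ∈ U ∧ (U : Set Disc) ⊆ DiscStar ∧
      ∀ (y : Disc) (hy : y ∈ U), IsIso (M.presheaf.germ U y hy))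
    (x : Disc) (hx0 : x ∈ DiscStar) :
    ∃ W : Set Disc, IsOpen W ∧ x ∈ W ∧ ∀ y ∈ W, ∀ e : St M y,
      ∃ f : ∀ x, St M x, f y = e ∧ ∀ z ∈ W, Gd U c idx f z := by
  obtain ⟨W, hxW, -, hW⟩ := hloc x hx0
  refine ⟨(W ⊓ U (idx x) : Opens Disc), (W ⊓ U (idx x)).2, ⟨hxW, hidx x⟩, fun y hy e => ?_⟩
  have := hW y hy.1
  obtain ⟨t, ht⟩ := (ConcreteCategory.bijective_of_isIso (M.presheaf.germ W y hy.1)).2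
    (e - cg U c (idx x) (idx y) y)
  obtain ⟨f, hf, hG⟩ := Gd_of_section U c idx (W ⊓ U (idx x)) (idx x) inf_le_right
    (M.presheaf.map (homOfLE (inf_le_left : W ⊓ U (idx x) ≤ W)).op t)
  refine ⟨f, ?_, hG⟩
  rw [hf y hy, gm_res]
  have ht : gm M y hy.1 t = e - cg U c (idx x) (idx y) y := ht
  rw [ht, sub_add_cancel]

end SheafPart

/-- If `M` is a sheaf of `ℂ`-vector spaces on the unit disc `Δ` that is constructible with
respect to the partition `Δ = {0} ∪ Δ*` — i.e. `M` restricted to `Δ*` is a local system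
of finite-dimensional `ℂ`-vector spaces and the stalk at `0` is finite-dimensional — then
`H^1(Δ, M) = 0`.  The vanishing of `H^1` is expressed via Čech cohomology: for every open
cover of `Δ`, every Čech `1`-cocycle is a coboundary (the Čech `H^1` of any open cover
injects into `H^1(Δ, M)`, and on the paracompact space `Δ` Čech cohomology computes sheaf
cohomology, so this condition is equivalent to `H^1(Δ, M) = 0`). -/
theorem statement3
    (M : TopCat.Sheaf (ModuleCat ℂ) Disc)
    -- local constancy on `Δ*`: every point of `Δ*` has an open neighbourhood `U ⊆ Δ*`
    -- on which `M` is constant, i.e. all germ maps `M(U) → M_y`, `y ∈ U`, are isomorphisms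
    (hloc : ∀ x ∈ DiscStar, ∃ U : Opens Disc, x ∈ U ∧ (U : Set Disc) ⊆ DiscStar ∧
      ∀ (y : Disc) (hy : y ∈ U), IsIso (M.presheaf.germ U y hy))
    -- all stalks (in particular the stalk at `0`) are finite-dimensional over `ℂ`
    (hfin : ∀ x : Disc, FiniteDimensional ℂ (M.presheaf.stalk x)) :
    ∀ (ι : Type) (U : ι → Opens Disc), (⨆ i, U i) = ⊤ →
      ∀ c : ∀ i j : ι, M.presheaf.obj (op (U i ⊓ U j)),
        (∀ i j k : ι,
            M.presheaf.map (homOfLE (le_inf ((inf_le_left (b := U k)).trans inf_le_left)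
              ((inf_le_left (b := U k)).trans inf_le_right))).op (c i j)
          + M.presheaf.map (homOfLE (le_inf ((inf_le_left (b := U k)).trans inf_le_right)
              (inf_le_right (a := U i ⊓ U j)))).op (c j k)
          = M.presheaf.map (homOfLE (le_inf ((inf_le_left (b := U k)).trans inf_le_left)
              (inf_le_right (a := U i ⊓ U j)))).op (c i k)) →
        ∃ b : ∀ i : ι, M.presheaf.obj (op (U i)),
          ∀ i j : ι,
            c i j = M.presheaf.map (homOfLE (inf_le_right (a := U i))).op (b j)
                  - M.presheaf.map (homOfLE (inf_le_left (b := U j))).op (b i) := by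
  intro ι U hU c hcoc
  have hex : ∀ x : Disc, ∃ i, x ∈ U i := fun x => by
    have : x ∈ (⨆ i, U i) := by rw [hU]; trivial
    exact Opens.mem_iSup.1 this
  choose idx hidx using hex
  have hc : ∀ i j k y, y ∈ U i → y ∈ U j → y ∈ U k →
      cg U c i j y + cg U c j k y = cg U c i k y := by
    intro i j k y hi hj hk
    have hy : y ∈ U i ⊓ U j ⊓ U k := ⟨⟨hi, hj⟩, hk⟩
    have := congrArg (gm M y hy) (hcoc i j k)
    rw [gm_add, gm_res, gm_res, gm_res] at this
    rw [cg_eq U c i j y ⟨hi, hj⟩, cg_eq U c j k y ⟨hj, hk⟩, cg_eq U c i k y ⟨hi, hk⟩]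
    exact this
  have hstar : ∀ x : UD, (x : ℂ) ≠ 0 → (show Disc from x) ∈ DiscStar := by
    intro x hx h
    apply hx
    exact congrArg Subtype.val h
  obtain ⟨f, hf⟩ : ∃ f : ∀ x, St M x, ∀ x, Gd U c idx f x := by
    refine UD.extend (E := fun x : UD => St M x) (Good := fun f x => Gd U c idx f x)
      (Gd_congr U c idx) (fun f g x hx => Gd_heq U c idx hidx hc hloc f g x (hstar x hx))
      (fun x hx => Gd_const U c idx hidx hloc x (hstar x hx)) ?_
    obtain ⟨f, -, hG⟩ := Gd_of_section U c idx (U (idx disc0)) (idx disc0) le_rfl 0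
    exact ⟨f, (U (idx disc0)).carrier, (U (idx disc0)).2, hidx disc0, hG⟩
  have hb : ∀ j, ∃ s : M.presheaf.obj (op (U j)), ∀ y (hy : y ∈ U j),
      gm M y hy s = f y - cg U c j (idx y) y := by
    intro j
    refine exists_section (U j) (fun y => f y - cg U c j (idx y) y) fun x hx => ?_
    obtain ⟨W, hxW, i, hW, t, ht⟩ := hf x
    refine ⟨W ⊓ U j, ⟨hxW, hx⟩, inf_le_right,
      M.presheaf.map (homOfLE (inf_le_left : W ⊓ U j ≤ W)).op t
      + M.presheaf.map (homOfLE (inf_le_inf_right _ hW : W ⊓ U j ≤ U i ⊓ U j)).op (c i j),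
      fun y hy => ?_⟩
    have := hc i j (idx y) y (hW hy.1) hy.2 (hidx y)
    rw [gm_add, gm_res, gm_res, ht y hy.1, ← this, cg_eq U c i j y ⟨hW hy.1, hy.2⟩]
    abel
  choose b hb using hb
  refine ⟨b, fun i j => gm_ext _ _ fun y hy => ?_⟩
  rw [gm_sub, gm_res, gm_res, hb, hb, ← hc i j (idx y) y hy.1 hy.2 (hidx y), cg_eq U c i j y hy]
  abel
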